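/- arXiv:1508.06861 — 3 statements merged into one kernel-verified Lean document; each statement's English description precedes it below -/
import Mathlib

section
/- For every a ∈ ℂ and every nonnegative integer n: Σ_{k=0}^{n} (a;q)_k (a;q)_{n−k} (−1)^k / ((q;q)_k (q;q)_{n−k}) equals 0 when n is odd, and equals (a²;q²)_m/(q²;q²)_m when n = 2m. -/
open Complex

/-- The finite q-shifted factorial `(a;q)_n`. -/
noncomputable def qPoch (q a : ℂ) (n : ℕ) : ℂ := ∏ j ∈ Finset.range n, (1 - a * q ^ j)

/-- The power series `∑ (a;q)_k / (q;q)_k X^k`, the left-hand side of the `q`-binomial theorem. -/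
noncomputable def qBinomialSeries (q a : ℂ) : PowerSeries ℂ :=
  PowerSeries.mk fun k => qPoch q a k / qPoch q q k

theorem qPoch_zero (q a : ℂ) : qPoch q a 0 = 1 :=
  Finset.prod_range_zero _

theorem qPoch_succ (q a : ℂ) (n : ℕ) : qPoch q a (n + 1) = qPoch q a n * (1 - a * q ^ n) :=
  Finset.prod_range_succ _ _

theorem constantCoeff_rescale_eq (c : ℂ) (F : PowerSeries ℂ) :
    PowerSeries.constantCoeff (PowerSeries.rescale c F) = PowerSeries.constantCoeff F := by
  rw [← PowerSeries.coeff_zero_eq_constantCoeff_apply, PowerSeries.coeff_rescale]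
  simp

/-- The `q`-difference equation `(1 - x) F(x) = (1 - a x) F(q x)`. -/
theorem one_sub_X_mul_qBinomialSeries {q : ℂ} (hq : ∀ n : ℕ, 1 - q ^ (n + 1) ≠ 0) (a : ℂ) :
    (1 - PowerSeries.X) * qBinomialSeries q a =
      (1 - PowerSeries.C a * PowerSeries.X) * PowerSeries.rescale q (qBinomialSeries q a) := by
  ext n
  cases n with
  | zero => simp [sub_mul, mul_assoc, constantCoeff_rescale_eq]
  | succ n =>
    have h₁ : 1 - q * q ^ n ≠ 0 := by simpa [pow_succ'] using hq n
    have h₂ : qPoch q a (n + 1) / qPoch q q (n + 1) * (1 - q * q ^ n) =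
        qPoch q a n / qPoch q q n * (1 - a * q ^ n) := by
      rw [qPoch_succ, qPoch_succ, mul_div_mul_comm, mul_assoc, div_mul_cancel₀ _ h₁]
    simp only [sub_mul, one_mul, mul_assoc, map_sub, PowerSeries.coeff_succ_X_mul,
      PowerSeries.coeff_C_mul, PowerSeries.coeff_rescale, qBinomialSeries, PowerSeries.coeff_mk]
    linear_combination h₂

/-- The product `F(-x) F(x)` satisfies `(1 - x²) G(x) = (1 - a² x²) G(q x)`. -/
theorem one_sub_X_sq_mul_qBinomialSeries {q : ℂ} (hq : ∀ n : ℕ, 1 - q ^ (n + 1) ≠ 0) (a : ℂ) :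
    (1 - PowerSeries.X ^ 2) *
        (PowerSeries.rescale (-1) (qBinomialSeries q a) * qBinomialSeries q a) =
      (1 - PowerSeries.C (a ^ 2) * PowerSeries.X ^ 2) * PowerSeries.rescale q
        (PowerSeries.rescale (-1) (qBinomialSeries q a) * qBinomialSeries q a) := by
  have h := one_sub_X_mul_qBinomialSeries hq a
  have h' := congrArg (PowerSeries.rescale (-1 : ℂ)) h
  have hC : PowerSeries.rescale (-1 : ℂ) (PowerSeries.C a) = PowerSeries.C a := by
    ext n
    cases n <;> simp [PowerSeries.coeff_rescale, PowerSeries.coeff_C]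
  simp only [map_mul, map_sub, map_one, PowerSeries.rescale_rescale, hC,
    PowerSeries.rescale_neg_one_X] at h'
  simp only [map_mul, map_pow, PowerSeries.rescale_rescale]
  rw [mul_comm (-1 : ℂ) q]
  linear_combination (1 + PowerSeries.X) *
      PowerSeries.rescale (-1) (qBinomialSeries q a) * h +
    (1 - PowerSeries.C a * PowerSeries.X) *
      PowerSeries.rescale q (qBinomialSeries q a) * h'

theorem sum_eq_coeff_qBinomialSeries (q a : ℂ) (n : ℕ) :
    ∑ k ∈ Finset.range (n + 1),
        qPoch q a k * qPoch q a (n - k) * (-1) ^ k / (qPoch q q k * qPoch q q (n - k)) =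
      PowerSeries.coeff n
        (PowerSeries.rescale (-1) (qBinomialSeries q a) * qBinomialSeries q a) := by
  rw [PowerSeries.coeff_mul, Finset.Nat.sum_antidiagonal_eq_sum_range_succ_mk]
  refine Finset.sum_congr rfl fun k _ => ?_
  simp only [PowerSeries.coeff_rescale, qBinomialSeries, PowerSeries.coeff_mk]
  ring

theorem coeff_add_two_of_q_difference {q b : ℂ} {G : PowerSeries ℂ}
    (hG : (1 - PowerSeries.X ^ 2) * G =
      (1 - PowerSeries.C b * PowerSeries.X ^ 2) * PowerSeries.rescale q G) (n : ℕ) :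
    (1 - q ^ (n + 2)) * PowerSeries.coeff (n + 2) G =
      (1 - b * q ^ n) * PowerSeries.coeff n G := by
  have h := congrArg (PowerSeries.coeff (n + 2)) hG
  simp only [sub_mul, one_mul, mul_assoc, map_sub, PowerSeries.coeff_X_pow_mul,
    PowerSeries.coeff_C_mul, PowerSeries.coeff_rescale] at h
  linear_combination h

theorem coeff_odd_of_q_difference {q b : ℂ} (hq : ∀ n : ℕ, 1 - q ^ (n + 1) ≠ 0)
    {G : PowerSeries ℂ} (hG : (1 - PowerSeries.X ^ 2) * G =
      (1 - PowerSeries.C b * PowerSeries.X ^ 2) * PowerSeries.rescale q G) (m : ℕ) :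
    PowerSeries.coeff (2 * m + 1) G = 0 := by
  induction m with
  | zero =>
    have h := congrArg (PowerSeries.coeff 1) hG
    simp [sub_mul, mul_assoc, PowerSeries.coeff_X_pow_mul', PowerSeries.coeff_rescale] at h
    refine (mul_eq_zero.1 ?_).resolve_left (hq 0)
    linear_combination h
  | succ m ih =>
    have h := coeff_add_two_of_q_difference hG (2 * m + 1)
    rw [ih, mul_zero] at h
    exact (mul_eq_zero.1 h).resolve_left (hq _)

theorem coeff_even_of_q_difference {q b : ℂ} (hq : ∀ n : ℕ, 1 - q ^ (n + 1) ≠ 0)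
    {G : PowerSeries ℂ} (hG : (1 - PowerSeries.X ^ 2) * G =
      (1 - PowerSeries.C b * PowerSeries.X ^ 2) * PowerSeries.rescale q G) (m : ℕ) :
    PowerSeries.coeff (2 * m) G =
      PowerSeries.coeff 0 G * (qPoch (q ^ 2) b m / qPoch (q ^ 2) (q ^ 2) m) := by
  induction m with
  | zero => simp [qPoch]
  | succ m ih =>
    have h := coeff_add_two_of_q_difference hG (2 * m)
    have h₁ : 1 - q ^ (2 * m + 2) ≠ 0 := hq _
    have h₂ : 1 - q ^ 2 * (q ^ 2) ^ m = 1 - q ^ (2 * m + 2) := by ring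
    rw [mul_add_one, qPoch_succ, qPoch_succ, h₂, mul_div_mul_comm, ← mul_assoc, ← ih,
      ← mul_div_assoc, eq_div_iff h₁, ← pow_mul]
    linear_combination h

/-- `Σ_{k=0}^{n} (a;q)_k (a;q)_{n−k} (−1)^k / ((q;q)_k (q;q)_{n−k})` equals `0`
when `n` is odd, and equals `(a²;q²)_m/(q²;q²)_m` when `n = 2m`. -/
theorem qPoch_alternating_convolution (q : ℝ) (hq0 : 0 < q) (hq1 : q < 1) (a : ℂ) (n : ℕ) :
    (Odd n →
      ∑ k ∈ Finset.range (n + 1),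
        qPoch (q : ℂ) a k * qPoch (q : ℂ) a (n - k) * (-1) ^ k /
          (qPoch (q : ℂ) (q : ℂ) k * qPoch (q : ℂ) (q : ℂ) (n - k)) = 0) ∧
    (∀ m : ℕ, n = 2 * m →
      ∑ k ∈ Finset.range (n + 1),
        qPoch (q : ℂ) a k * qPoch (q : ℂ) a (n - k) * (-1) ^ k /
          (qPoch (q : ℂ) (q : ℂ) k * qPoch (q : ℂ) (q : ℂ) (n - k))
      = qPoch ((q : ℂ) ^ 2) (a ^ 2) m / qPoch ((q : ℂ) ^ 2) ((q : ℂ) ^ 2) m) := by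
  have hq (k : ℕ) : 1 - (q : ℂ) ^ (k + 1) ≠ 0 := by
    have h : q ^ (k + 1) ≠ 1 := (pow_lt_one₀ hq0.le hq1 k.succ_ne_zero).ne
    exact sub_ne_zero.2 (by exact_mod_cast h.symm)
  have hG := one_sub_X_sq_mul_qBinomialSeries hq a
  rw [sum_eq_coeff_qBinomialSeries]
  refine ⟨?_, ?_⟩
  · rintro ⟨m, rfl⟩
    exact coeff_odd_of_q_difference hq hG m
  · rintro m rfl
    rw [coeff_even_of_q_difference hq hG m]
    simp [qBinomialSeries, constantCoeff_rescale_eq, qPoch_zero]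
end

section
/- Rogers–Ramanujan type identity: for every x ∈ ℂ with x ≠ 0: ((q;q)_∞² / (−q;q)_∞²) · Σ_{n=−∞}^∞ q^{4n²} x^{2n} / (1 + q^{2n+1}) = Σ_{j,k=−∞}^∞ q^{(j+k)²} (−1)^j x^{j+k} / ((1 + i q^{j+1/2})(1 + i q^{k+1/2})), where i is the imaginary unit and q^{j+1/2} = exp((j+1/2) log q); both sides converge absolutely. -/
open Complex

/-- The infinite q-shifted factorial `(a;q)_∞`. -/
noncomputable def qPochInf (q a : ℂ) : ℂ := ∏' j : ℕ, (1 - a * q ^ j)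

/-- The finite quotient `(−q;q)_n / (q;q)_n`. -/
noncomputable def qRatio (q : ℂ) (n : ℕ) : ℂ :=
  ∏ j ∈ Finset.range n, (1 + q ^ (j + 1)) / (1 - q ^ (j + 1))

/-- The nodes `q^k + q^{-k}` of the partial fraction expansion. -/
noncomputable def qNode (q : ℂ) (k : ℕ) : ℂ := q ^ k + (q ^ k)⁻¹

lemma one_sub_pow_ne_zero {q : ℂ} (h1 : ‖q‖ < 1) (k : ℕ) : 1 - q ^ (k + 1) ≠ 0 := by
  intro h
  have h2 : ‖q ^ (k + 1)‖ < 1 := by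
    rw [norm_pow]; exact pow_lt_one₀ (norm_nonneg _) h1 (by omega)
  rw [← sub_eq_zero.1 h] at h2
  simp at h2

lemma one_add_pow_ne_zero {q : ℂ} (h1 : ‖q‖ < 1) (k : ℕ) : 1 + q ^ (k + 1) ≠ 0 := by
  intro h
  have h2 : ‖q ^ (k + 1)‖ < 1 := by
    rw [norm_pow]; exact pow_lt_one₀ (norm_nonneg _) h1 (by omega)
  rw [eq_neg_of_add_eq_zero_right h] at h2
  simp at h2

lemma qRatio_succ (q : ℂ) (n : ℕ) :
    qRatio q (n + 1) = qRatio q n * ((1 + q ^ (n + 1)) / (1 - q ^ (n + 1))) :=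
  Finset.prod_range_succ _ _

lemma qRatio_ne_zero {q : ℂ} (h1 : ‖q‖ < 1) (n : ℕ) : qRatio q n ≠ 0 :=
  Finset.prod_ne_zero_iff.2 fun j _ =>
    div_ne_zero (one_add_pow_ne_zero h1 j) (one_sub_pow_ne_zero h1 j)

lemma qNode_add_sub {q : ℂ} (h0 : q ≠ 0) (k d : ℕ) :
    qNode q (k + d) + qNode q k = (q ^ (k + d))⁻¹ * ((1 + q ^ d) * (1 + q ^ (2 * k + d))) ∧
    qNode q (k + d) - qNode q k = (q ^ (k + d))⁻¹ * ((1 - q ^ d) * (1 - q ^ (2 * k + d))) := by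
  have := pow_ne_zero k h0
  have := pow_ne_zero d h0
  unfold qNode
  constructor <;> (simp only [pow_add, two_mul]; field_simp; ring)

lemma qNode_sub_ne_zero {q : ℂ} (h0 : q ≠ 0) (h1 : ‖q‖ < 1) {k M : ℕ} (h : k < M) :
    qNode q M - qNode q k ≠ 0 := by
  obtain ⟨d, rfl⟩ := Nat.exists_eq_add_of_lt h
  rw [add_assoc, (qNode_add_sub h0 k (d + 1)).2]
  exact mul_ne_zero (inv_ne_zero (pow_ne_zero _ h0))
    (mul_ne_zero (one_sub_pow_ne_zero h1 d) (one_sub_pow_ne_zero h1 (2 * k + d)))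

/-- The node ratio as a quotient of values of `qRatio`. -/
lemma qNode_ratio {q : ℂ} (h0 : q ≠ 0) (k d : ℕ) :
    qRatio q d * qRatio q (2 * k + d) *
      ((qNode q (k + (d + 1)) + qNode q k) / (qNode q (k + (d + 1)) - qNode q k)) =
    qRatio q (d + 1) * qRatio q (2 * k + (d + 1)) := by
  rw [(qNode_add_sub h0 k (d + 1)).1, (qNode_add_sub h0 k (d + 1)).2, ← add_assoc (2 * k) d 1,
    qRatio_succ, qRatio_succ, mul_div_mul_left _ _ (inv_ne_zero (pow_ne_zero _ h0)),
    mul_div_mul_comm]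
  ring

lemma prod_qNode_ratio {q : ℂ} (h0 : q ≠ 0) (h1 : ‖q‖ < 1) (c r : ℕ) :
    (∏ k ∈ Finset.range r, (qNode q (k + 1) + qNode q (r + c + 1)) /
      (qNode q (k + 1) - qNode q (r + c + 1))) * (qRatio q c * qRatio q (r + c + 1)) =
      (-1) ^ r * (qRatio q (r + c) * qRatio q (2 * r + c + 1)) := by
  suffices H : ∀ s ≤ r, (∏ k ∈ Finset.range s, (qNode q (k + 1) + qNode q (r + c + 1)) /
      (qNode q (k + 1) - qNode q (r + c + 1))) * (qRatio q (r - s + c) * qRatio q (r + c + 1)) =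
      (-1) ^ s * (qRatio q (r + c) * qRatio q (r + s + c + 1)) by
    have := H r le_rfl
    rwa [Nat.sub_self, zero_add, ← two_mul] at this
  intro s
  induction s with
  | zero => intro _; simp
  | succ s ih =>
    intro hs
    have ih := ih (by omega)
    obtain ⟨e, rfl⟩ := Nat.exists_eq_add_of_le hs
    have hR := qNode_ratio h0 (s + 1) (e + c)
    rw [show s + 1 + (e + c + 1) = s + 1 + e + c + 1 by ring,
      show 2 * (s + 1) + (e + c) = s + 1 + e + s + c + 1 by ring,
      show 2 * (s + 1) + (e + c + 1) = s + 1 + e + (s + 1) + c + 1 by ring] at hR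
    rw [show s + 1 + e - s + c = e + c + 1 by omega] at ih
    rw [show s + 1 + e - (s + 1) + c = e + c by omega, Finset.prod_range_succ]
    have hne := qRatio_ne_zero h1 (s + 1 + e + s + c + 1)
    have hne2 := qRatio_ne_zero h1 (e + c + 1)
    have hneg : (qNode q (s + 1) + qNode q (s + 1 + e + c + 1)) /
        (qNode q (s + 1) - qNode q (s + 1 + e + c + 1)) =
        -((qNode q (s + 1 + e + c + 1) + qNode q (s + 1)) /
        (qNode q (s + 1 + e + c + 1) - qNode q (s + 1))) := by
      rw [← div_neg, neg_sub, add_comm]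
    rw [hneg]
    generalize (qNode q (s + 1 + e + c + 1) + qNode q (s + 1)) /
        (qNode q (s + 1 + e + c + 1) - qNode q (s + 1)) = X at *
    generalize (∏ k ∈ Finset.range s, _ : ℂ) = Y at *
    apply mul_left_cancel₀ hne
    apply mul_left_cancel₀ hne2
    rw [pow_succ]
    linear_combination (-qRatio q (e + c) * X * qRatio q (s + 1 + e + s + c + 1)) * ih -
      (-1) ^ s * qRatio q (s + 1 + e + c) * qRatio q (s + 1 + e + s + c + 1) * hR

/-- The multiplicity of `±i`. -/
def symWeight (i : ℕ) : ℂ := if i = 0 then 1 else 2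

lemma top_residue {q : ℂ} (h0 : q ≠ 0) (h1 : ‖q‖ < 1) (m : ℕ) :
    -2 * qNode q (m + 1) * ((∏ k ∈ Finset.range m, (qNode q (k + 1) + qNode q (m + 1)) /
      (qNode q (k + 1) - qNode q (m + 1))) / (qNode q (m + 1) - 2)) =
      2 * (-1) ^ (m + 1) * qRatio q (2 * (m + 1)) := by
  have h := prod_qNode_ratio h0 h1 0 m
  rw [add_zero, add_zero, qRatio_succ q m, show qRatio q 0 = 1 by simp [qRatio], one_mul] at h
  have hne := qRatio_ne_zero h1 m
  have h2 : qNode q (m + 1) - 2 ≠ 0 := by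
    have := qNode_sub_ne_zero h0 h1 (Nat.succ_pos m)
    rwa [show qNode q 0 = 2 by simp [qNode]; norm_num] at this
  rw [show 2 * (m + 1) = 2 * m + 1 + 1 by ring, qRatio_succ]
  generalize (∏ k ∈ Finset.range m, _ : ℂ) = Y at *
  have a1 := one_add_pow_ne_zero h1 m
  have a2 := one_sub_pow_ne_zero h1 m
  have a3 := one_sub_pow_ne_zero h1 (2 * m + 1)
  have a4 := pow_ne_zero (m + 1) h0
  have hY : Y = (-1) ^ m * qRatio q (2 * m + 1) * ((1 - q ^ (m + 1)) / (1 + q ^ (m + 1))) := by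
    field_simp at h ⊢
    linear_combination h
  rw [hY]
  rw [show 2 * m + 1 + 1 = (m + 1) * 2 by ring, pow_mul] at a3 ⊢
  unfold qNode at *
  generalize q ^ (m + 1) = z at *
  have e1 : z + z⁻¹ - 2 = (1 - z) ^ 2 * z⁻¹ := by field_simp; ring
  have e2 : 1 - z ^ 2 = (1 - z) * (1 + z) := by ring
  rw [e1, e2, pow_succ]
  field_simp
  ring

/-- Partial fraction expansion of `∏ (t_k + s)/(t_k - s) / (s - t_0)`. -/
lemma partial_fractions {q : ℂ} (h0 : q ≠ 0) (h1 : ‖q‖ < 1) (m : ℕ) :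
    ∀ s : ℂ, (∀ k ≤ m, s - qNode q k ≠ 0) →
    ∑ i ∈ Finset.range (m + 1), symWeight i * (-1) ^ i *
      (qRatio q (m - i) * qRatio q (m + i)) / (s - qNode q i) =
    (∏ k ∈ Finset.range m, (qNode q (k + 1) + s) / (qNode q (k + 1) - s)) / (s - 2) := by
  induction m with
  | zero =>
    intro s hs
    simp [symWeight, qRatio, qNode]
    norm_num
  | succ m ih =>
    intro s hs
    have hs' := ih s fun k hk => hs k (by omega)
    have hM := ih (qNode q (m + 1)) fun k hk => qNode_sub_ne_zero h0 h1 (by omega)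
    have hres := top_residue h0 h1 m
    rw [← hM] at hres
    have hsm := hs (m + 1) le_rfl
    have hsm' : qNode q (m + 1) - s ≠ 0 := by rw [← neg_sub]; exact neg_ne_zero.2 hsm
    rw [Finset.prod_range_succ, mul_div_right_comm, ← hs', Finset.sum_range_succ _ (m + 1),
      Nat.sub_self, ← two_mul, show qRatio q 0 = 1 by simp [qRatio], one_mul]
    have hw : symWeight (m + 1) = 2 := by simp [symWeight]
    rw [hw, ← hres, Finset.mul_sum, Finset.sum_div, Finset.sum_mul, ← Finset.sum_add_distrib]
    refine Finset.sum_congr rfl fun i hi => ?_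
    have him : i ≤ m := by simpa [Nat.lt_succ_iff] using hi
    have hti := qNode_sub_ne_zero h0 h1 (Nat.lt_succ_of_le him)
    have hsi := hs i (by omega)
    obtain ⟨d, rfl⟩ := Nat.exists_eq_add_of_le him
    have hR := qNode_ratio h0 i d
    rw [show i + d + 1 - i = d + 1 by omega, show i + d - i = d by omega,
      show i + d + 1 + i = 2 * i + (d + 1) by ring, show i + d + i = 2 * i + d by ring, ← hR]
    rw [Nat.succ_eq_add_one] at hti
    rw [← add_assoc i d 1]
    generalize qNode q (i + d + 1) = M at *
    generalize qNode q i = t at *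
    field_simp
    ring

open Filter Topology

lemma summable_norm_pow_succ {q : ℂ} (h1 : ‖q‖ < 1) (c : ℂ) :
    Summable fun j : ℕ => ‖-(c * q * q ^ j)‖ := by
  simp only [norm_neg, norm_mul, norm_pow]
  exact (summable_geometric_of_lt_one (norm_nonneg _) h1).mul_left _

lemma tendsto_qPochInf {q : ℂ} (h1 : ‖q‖ < 1) (c : ℂ) :
    Tendsto (fun n => ∏ j ∈ Finset.range n, (1 - c * q * q ^ j)) atTop (𝓝 (qPochInf q (c * q))) := by
  have h := (multipliable_one_add_of_summable (summable_norm_pow_succ h1 c)).tendsto_prod_tprod_nat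
  simpa only [qPochInf, ← sub_eq_add_neg] using h

lemma qPochInf_self_ne_zero {q : ℂ} (h1 : ‖q‖ < 1) : qPochInf q q ≠ 0 := by
  have h := tprod_one_add_ne_zero_of_summable (f := fun j : ℕ => -(1 * q * q ^ j)) (fun j => by
    simpa [pow_succ', ← sub_eq_add_neg] using one_sub_pow_ne_zero h1 j)
    (summable_norm_pow_succ h1 1)
  simpa only [qPochInf, ← sub_eq_add_neg, one_mul] using h

lemma qPochInf_neg_self_ne_zero {q : ℂ} (h1 : ‖q‖ < 1) : qPochInf q (-q) ≠ 0 := by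
  have h := tprod_one_add_ne_zero_of_summable (f := fun j : ℕ => -(-1 * q * q ^ j)) (fun j => by
    simpa [pow_succ'] using one_add_pow_ne_zero h1 j)
    (summable_norm_pow_succ h1 (-1))
  simpa only [qPochInf, ← sub_eq_add_neg, neg_one_mul] using h

lemma tendsto_qRatio {q : ℂ} (h1 : ‖q‖ < 1) :
    Tendsto (qRatio q) atTop (𝓝 (qPochInf q (-q) / qPochInf q q)) := by
  have ha := tendsto_qPochInf h1 (-1)
  have hb := tendsto_qPochInf h1 1
  rw [neg_one_mul] at ha
  rw [one_mul] at hb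
  refine (ha.div hb (qPochInf_self_ne_zero h1)).congr fun n => ?_
  rw [Pi.div_apply, ← Finset.prod_div_distrib]
  exact Finset.prod_congr rfl fun j _ => by rw [pow_succ']; ring

/-- The unimodular factor `(1 - iy)/(1 + iy)`. -/
noncomputable def cayley (y : ℝ) : ℂ := (1 - I * y) / (1 + I * y)

lemma one_add_I_mul_ne_zero (y : ℝ) : (1 : ℂ) + I * y ≠ 0 := by
  intro h
  simpa using congrArg re h

lemma one_sub_I_mul_ne_zero (y : ℝ) : (1 : ℂ) - I * y ≠ 0 := by
  intro h
  simpa using congrArg re h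

lemma cayley_ne_zero (y : ℝ) : cayley y ≠ 0 :=
  div_ne_zero (one_sub_I_mul_ne_zero y) (one_add_I_mul_ne_zero y)

lemma cayley_mul_cayley_inv {y : ℝ} (hy : y ≠ 0) : cayley y * cayley y⁻¹ = -1 := by
  have h1 := one_add_I_mul_ne_zero y
  have h2 := one_add_I_mul_ne_zero y⁻¹
  have hy' : (y : ℂ) ≠ 0 := by exact_mod_cast hy
  unfold cayley
  rw [div_mul_div_comm, div_eq_iff (mul_ne_zero h1 h2)]
  push_cast
  field_simp
  linear_combination (2 * (y : ℂ)) * I_sq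

lemma tendsto_cayley_zero : Tendsto cayley (𝓝 0) (𝓝 1) := by
  have : ContinuousAt cayley 0 := by
    unfold cayley
    refine ContinuousAt.div (by fun_prop) (by fun_prop) (one_add_I_mul_ne_zero 0)
  simpa [ContinuousAt, cayley] using this

/-- The alternating-sign symmetric product `(-1)^m ∏_{|k| ≤ m} cayley (q^k y)`. -/
noncomputable def cayleyProd (q y : ℝ) (m : ℕ) : ℂ :=
  cayley y * ∏ k ∈ Finset.range m, -(cayley (q ^ (k + 1) * y) * cayley ((q ^ (k + 1))⁻¹ * y))

lemma cayleyProd_succ (q y : ℝ) (m : ℕ) : cayleyProd q y (m + 1) =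
    cayleyProd q y m * -(cayley (q ^ (m + 1) * y) * cayley ((q ^ (m + 1))⁻¹ * y)) := by
  unfold cayleyProd
  rw [Finset.prod_range_succ, mul_assoc]

lemma cayleyProd_shift {q : ℝ} (hq : q ≠ 0) (y : ℝ) (m : ℕ) :
    cayleyProd q (q * y) m * cayley ((q ^ m)⁻¹ * y) =
      cayleyProd q y m * cayley (q ^ (m + 1) * y) := by
  induction m with
  | zero => simp [cayleyProd, mul_comm]
  | succ m ih =>
    rw [cayleyProd_succ, cayleyProd_succ, show q ^ (m + 1) * (q * y) = q ^ (m + 1 + 1) * y by ring,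
      show (q ^ (m + 1))⁻¹ * (q * y) = (q ^ m)⁻¹ * y by field_simp; ring]
    linear_combination (-cayley (q ^ (m + 1 + 1) * y) * cayley ((q ^ (m + 1))⁻¹ * y)) * ih

lemma cayleyProd_of_sq {q h : ℝ} (hq : q ≠ 0) (hh : h ^ 2 = q) (m : ℕ) :
    cayleyProd q h m = cayley (q ^ m * h) := by
  have h0 : h ≠ 0 := by rintro rfl; simp at hh; exact hq hh.symm
  induction m with
  | zero => simp [cayleyProd]
  | succ m ih =>
    have := cayley_mul_cayley_inv (y := q ^ m * h) (by positivity)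
    rw [cayleyProd_succ, ih, show (q ^ (m + 1))⁻¹ * h = (q ^ m * h)⁻¹ by
      rw [pow_succ]; nth_rw 2 [← hh]; field_simp]
    linear_combination (-cayley (q ^ (m + 1) * h)) * this

lemma tendsto_cayley_pow_mul {q : ℝ} (h0 : 0 < q) (h1 : q < 1) (y : ℝ) :
    Tendsto (fun m : ℕ => cayley (q ^ m * y)) atTop (𝓝 1) := by
  refine tendsto_cayley_zero.comp ?_
  simpa using (tendsto_pow_atTop_nhds_zero_of_lt_one h0.le h1).mul_const y

lemma cayleyProd_mul_left {q : ℝ} (hq : q ≠ 0) {y : ℝ} (hy : y ≠ 0) (m : ℕ) :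
    cayleyProd q (q * y) m =
      -(cayleyProd q y m * (cayley (q ^ (m + 1) * y) * cayley (q ^ m * y⁻¹))) := by
  have h := cayleyProd_shift hq y m
  have h2 := cayley_mul_cayley_inv (y := q ^ m * y⁻¹) (by positivity)
  rw [mul_inv, inv_inv] at h2
  linear_combination cayleyProd q (q * y) m * h2 - cayley (q ^ m * y⁻¹) * h

lemma tendsto_cayleyProd_mul_left_iff {q : ℝ} (h0 : 0 < q) (h1 : q < 1) {y : ℝ} (hy : y ≠ 0)
    (a : ℂ) : Tendsto (cayleyProd q (q * y)) atTop (𝓝 (-a)) ↔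
      Tendsto (cayleyProd q y) atTop (𝓝 a) := by
  have hc : Tendsto (fun m : ℕ => cayley (q ^ (m + 1) * y) * cayley (q ^ m * y⁻¹)) atTop
      (𝓝 1) := by
    simpa using ((tendsto_cayley_pow_mul h0 h1 y).comp (tendsto_add_atTop_nat 1)).mul
      (tendsto_cayley_pow_mul h0 h1 y⁻¹)
  constructor
  · intro h
    have := (h.div hc one_ne_zero).neg
    rw [div_one, neg_neg] at this
    refine this.congr fun m => ?_
    rw [Pi.div_apply, cayleyProd_mul_left h0.ne' hy, neg_div, neg_neg,
      mul_div_cancel_right₀ _ (mul_ne_zero (cayley_ne_zero _) (cayley_ne_zero _))]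
  · intro h
    have := (h.mul hc).neg
    rw [mul_one] at this
    exact this.congr fun m => (cayleyProd_mul_left h0.ne' hy m).symm

lemma tendsto_cayleyProd {q h : ℝ} (h0 : 0 < q) (h1 : q < 1) (hh : h ^ 2 = q) (n : ℤ) :
    Tendsto (cayleyProd q (q ^ n * h)) atTop (𝓝 ((-1) ^ n)) := by
  have hne : h ≠ 0 := by rintro rfl; simp at hh; exact h0.ne hh
  have step (k : ℤ) : Tendsto (cayleyProd q (q ^ (k + 1) * h)) atTop (𝓝 ((-1) ^ (k + 1))) ↔
      Tendsto (cayleyProd q (q ^ k * h)) atTop (𝓝 ((-1) ^ k)) := by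
    rw [← tendsto_cayleyProd_mul_left_iff h0 h1 (mul_ne_zero (zpow_ne_zero k h0.ne') hne),
      zpow_add_one₀ h0.ne', zpow_add_one₀ (by norm_num), mul_comm (q ^ k) q, mul_assoc, mul_neg_one]
  induction n with
  | zero =>
    simp only [zpow_zero, one_mul]
    exact (tendsto_cayley_pow_mul h0 h1 h).congr fun m => (cayleyProd_of_sq h0.ne' hh m).symm
  | succ n ih => exact (step n).2 ih
  | pred n ih => exact (step _).1 (by simpa using ih)

lemma norm_one_add_I_mul_inv_le (y : ℝ) : ‖(1 + I * (y : ℂ))⁻¹‖ ≤ 1 := by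
  rw [norm_inv]
  refine inv_le_one_of_one_le₀ ?_
  simpa using abs_re_le_norm (1 + I * (y : ℂ))

lemma norm_one_add_I_mul_inv_le_inv {y : ℝ} (hy : 0 < y) : ‖(1 + I * (y : ℂ))⁻¹‖ ≤ y⁻¹ := by
  rw [norm_inv]
  refine inv_anti₀ hy ?_
  simpa [abs_of_pos hy] using abs_im_le_norm (1 + I * (y : ℂ))

/-- The product `1 / ((1 + i q^j h)(1 + i q^k h))`. -/
noncomputable def pairTerm (q h : ℝ) (j k : ℤ) : ℂ :=
  (1 + I * ((q ^ j * h : ℝ) : ℂ))⁻¹ * (1 + I * ((q ^ k * h : ℝ) : ℂ))⁻¹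

lemma norm_pairTerm_le {q h : ℝ} (h0 : 0 < q) (hh : 0 < h) (j N : ℤ) :
    ‖pairTerm q h j (N - j)‖ ≤ h⁻¹ * (1 + (q ^ N)⁻¹) * q ^ j.natAbs := by
  unfold pairTerm
  rw [norm_mul]
  have hN : 0 < q ^ N := zpow_pos h0 N
  have hj : 0 < q ^ j.natAbs := pow_pos h0 _
  rcases le_total 0 j with hj0 | hj0
  · have e : q ^ j = q ^ j.natAbs := by
      rw [← zpow_natCast, Int.natAbs_of_nonneg hj0]
    calc _ ≤ 1 * (q ^ (N - j) * h)⁻¹ := by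
          gcongr
          · exact norm_one_add_I_mul_inv_le _
          · exact norm_one_add_I_mul_inv_le_inv (by positivity)
      _ = h⁻¹ * (0 + (q ^ N)⁻¹) * q ^ j.natAbs := by
          rw [zpow_sub₀ h0.ne', e]; field_simp; ring
      _ ≤ _ := by gcongr; norm_num
  · have e : q ^ j = (q ^ j.natAbs)⁻¹ := by
      rw [← zpow_natCast, ← zpow_neg, Int.ofNat_natAbs_of_nonpos hj0, neg_neg]
    calc _ ≤ (q ^ j * h)⁻¹ * 1 := by
          gcongr
          · exact norm_one_add_I_mul_inv_le_inv (by positivity)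
          · exact norm_one_add_I_mul_inv_le _
      _ = h⁻¹ * (1 + 0) * q ^ j.natAbs := by
          rw [e]; field_simp; ring
      _ ≤ _ := by gcongr; positivity

lemma summable_pow_natAbs {q : ℝ} (h0 : 0 < q) (h1 : q < 1) :
    Summable fun j : ℤ => q ^ j.natAbs := by
  refine Summable.of_nat_of_neg ?_ ?_ <;>
    simpa using summable_geometric_of_lt_one h0.le h1

lemma pairTerm_comm (q h : ℝ) (j k : ℤ) : pairTerm q h j k = pairTerm q h k j := mul_comm _ _

lemma pairTerm_eq_div {q h : ℝ} (h0 : 0 < q) (hh : 0 < h) (n : ℤ) (i : ℕ) :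
    -I * (q ^ n * h : ℝ) + (-I * (q ^ n * h : ℝ))⁻¹ - qNode q i ≠ 0 ∧
    pairTerm q h (n + i) (n - i) =
      (-I * (q ^ n * h : ℝ))⁻¹ / (-I * (q ^ n * h : ℝ) + (-I * (q ^ n * h : ℝ))⁻¹ - qNode q i) := by
  have hy : 0 < q ^ n * h := by positivity
  have a1 := one_add_I_mul_ne_zero (q ^ (n + i : ℤ) * h)
  have a2 := one_add_I_mul_ne_zero (q ^ (n - i : ℤ) * h)
  unfold pairTerm
  rw [zpow_add₀ h0.ne', zpow_natCast] at *
  rw [zpow_sub₀ h0.ne', zpow_natCast] at *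
  rw [show q ^ n * q ^ i * h = q ^ n * h * q ^ i by ring] at *
  rw [show q ^ n / q ^ i * h = q ^ n * h / q ^ i by ring] at *
  have hq : ((q : ℂ) ^ i) ≠ 0 := by exact_mod_cast (pow_pos h0 i).ne'
  generalize q ^ n * h = y at *
  have hy' : (y : ℂ) ≠ 0 := by exact_mod_cast hy.ne'
  push_cast at *
  have hI := I_ne_zero
  have key : -I * (y : ℂ) + (-I * (y : ℂ))⁻¹ - qNode q i =
      (-I * (y : ℂ))⁻¹ * ((1 + I * (y * (q : ℂ) ^ i)) * (1 + I * (y / (q : ℂ) ^ i))) := by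
    unfold qNode
    field_simp
    ring
  have hb : (-I * (y : ℂ))⁻¹ ≠ 0 := inv_ne_zero (mul_ne_zero (neg_ne_zero.2 hI) hy')
  rw [key]
  refine ⟨mul_ne_zero hb (mul_ne_zero a1 a2), ?_⟩
  rw [← mul_inv]
  field_simp

lemma finite_sum_pairTerm {q h : ℝ} (h0 : 0 < q) (h1 : q < 1) (hh : 0 < h) (n : ℤ) (m : ℕ) :
    ∑ i ∈ Finset.range (m + 1), symWeight i * (-1) ^ i *
      (qRatio q (m - i) * qRatio q (m + i)) * pairTerm q h (n + i) (n - i) =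
    cayleyProd q (q ^ n * h) m / (1 + ((q ^ n * h : ℝ) : ℂ) ^ 2) := by
  have hqc : (q : ℂ) ≠ 0 := by exact_mod_cast h0.ne'
  have hqn : ‖(q : ℂ)‖ < 1 := by simpa [abs_of_pos h0] using h1
  have hpf := partial_fractions hqc hqn m _ fun k _ => (pairTerm_eq_div h0 hh n k).1
  have hy : 0 < q ^ n * h := by positivity
  have hs2 := (pairTerm_eq_div h0 hh n 0).1
  have hnode := fun k => (pairTerm_eq_div h0 hh n k).1
  simp_rw [fun i : ℕ => (pairTerm_eq_div h0 hh n i).2]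
  generalize q ^ n * h = y at *
  have hy' : (y : ℂ) ≠ 0 := by exact_mod_cast hy.ne'
  have a1 := one_add_I_mul_ne_zero y
  have a2 := one_sub_I_mul_ne_zero y
  have e : (1 : ℂ) + (y : ℂ) ^ 2 = (1 + I * y) * (1 - I * y) := by
    linear_combination (y : ℂ) ^ 2 * I_sq
  have hI := I_ne_zero
  have hprod : ∏ k ∈ Finset.range m, (qNode q (k + 1) + (-I * (y : ℂ) + (-I * (y : ℂ))⁻¹)) /
      (qNode q (k + 1) - (-I * (y : ℂ) + (-I * (y : ℂ))⁻¹)) =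
      ∏ k ∈ Finset.range m, -(cayley (q ^ (k + 1) * y) * cayley ((q ^ (k + 1))⁻¹ * y)) := by
    refine Finset.prod_congr rfl fun k _ => ?_
    have hk := hnode (k + 1)
    have b1 := one_add_I_mul_ne_zero (q ^ (k + 1) * y)
    have b2 := one_add_I_mul_ne_zero ((q ^ (k + 1))⁻¹ * y)
    have hz : (q : ℂ) ^ (k + 1) ≠ 0 := pow_ne_zero _ hqc
    rw [← neg_sub, div_neg]
    unfold cayley
    rw [div_mul_div_comm, neg_inj, div_eq_div_iff hk (mul_ne_zero b1 b2)]
    push_cast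
    unfold qNode
    generalize (q : ℂ) ^ (k + 1) = z at *
    have : ((-I * (y : ℂ)))⁻¹ = I * (y : ℂ)⁻¹ := by
      rw [mul_inv, inv_neg, inv_I, neg_neg]
    rw [this]
    field_simp
    ring_nf
    simp only [I_sq, show I ^ 3 = -I by rw [pow_succ, I_sq]; ring]
    ring
  rw [hprod] at hpf
  rw [e]
  calc _ = (-I * (y : ℂ))⁻¹ * ∑ i ∈ Finset.range (m + 1), symWeight i * (-1) ^ i *
      (qRatio q (m - i) * qRatio q (m + i)) /
        (-I * (y : ℂ) + (-I * (y : ℂ))⁻¹ - qNode q i) := by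
        rw [Finset.mul_sum]; exact Finset.sum_congr rfl fun i _ => by ring
    _ = _ := by
      rw [hpf, cayleyProd, cayley]
      generalize (∏ k ∈ Finset.range m, _ : ℂ) = Y
      have : -I * (y : ℂ) + (-I * (y : ℂ))⁻¹ - 2 = (-I * (y : ℂ))⁻¹ * (1 + I * y) ^ 2 := by
        field_simp
        ring
      rw [this]
      field_simp

lemma hasSum_even_of_nat {f : ℤ → ℂ} (hf : Summable f) (he : ∀ i, f (-i) = f i) :
    HasSum f (∑' i : ℕ, symWeight i * f i) := by
  have hn : Summable fun i : ℕ => f i := hf.comp_injective Nat.cast_injective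
  have hs : Summable fun i : ℕ => f ((i : ℤ) + 1) := by
    simpa using (summable_nat_add_iff 1).2 hn
  have hw : Summable fun i : ℕ => symWeight i * f i := by
    rw [← summable_nat_add_iff 1]
    simpa [symWeight] using hs.mul_left 2
  have := hn.hasSum.of_nat_of_neg_add_one (f := f) (by simpa only [he] using hs.hasSum)
  convert this using 1
  rw [hw.tsum_eq_zero_add, hn.tsum_eq_zero_add]
  simp [symWeight, tsum_mul_left]
  ring

lemma exists_norm_qRatio_le {q : ℂ} (h1 : ‖q‖ < 1) : ∃ B, ∀ n, ‖qRatio q n‖ ≤ B := by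
  obtain ⟨B, hB⟩ := (tendsto_qRatio h1).norm.bddAbove_range
  exact ⟨B, fun n => hB ⟨n, rfl⟩⟩

lemma summable_pairTerm {q h : ℝ} (h0 : 0 < q) (h1 : q < 1) (hh : 0 < h) (N : ℤ) :
    Summable fun j : ℤ => ‖pairTerm q h j (N - j)‖ :=
  ((summable_pow_natAbs h0 h1).mul_left _).of_nonneg_of_le (fun _ => norm_nonneg _)
    fun j => norm_pairTerm_le h0 hh j N

lemma summable_pairTerm_centered {q h : ℝ} (h0 : 0 < q) (h1 : q < 1) (hh : 0 < h) (n : ℤ) :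
    Summable fun i : ℤ => ‖pairTerm q h (n + i) (n - i)‖ := by
  have := (summable_pairTerm h0 h1 hh (2 * n)).comp_injective (Equiv.addLeft n).injective
  refine this.congr fun i => ?_
  simp only [Function.comp, Equiv.coe_addLeft]
  congr 2
  ring

lemma norm_symWeight_le (i : ℕ) : ‖symWeight i‖ ≤ 2 := by
  unfold symWeight
  split_ifs <;> norm_num

lemma tsum_symWeight_pairTerm {q h : ℝ} (h0 : 0 < q) (h1 : q < 1) (hh : 0 < h) (hq : h ^ 2 = q)
    (n : ℤ) :
    (qPochInf q (-q) / qPochInf q q) ^ 2 *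
      ∑' i : ℕ, symWeight i * (-1) ^ i * pairTerm q h (n + i) (n - i) =
    (-1) ^ n / (1 + ((q ^ n * h : ℝ) : ℂ) ^ 2) := by
  have hqn : ‖(q : ℂ)‖ < 1 := by simpa [abs_of_pos h0] using h1
  set L := qPochInf (q : ℂ) (-q) / qPochInf q q with hL
  have hlim := tendsto_qRatio hqn
  rw [← hL] at hlim
  obtain ⟨B, hB⟩ := exists_norm_qRatio_le hqn
  have hB0 : 0 ≤ B := (norm_nonneg _).trans (hB 0)
  let F : ℕ → ℕ → ℂ := fun m i => if i ∈ Finset.range (m + 1) then symWeight i * (-1) ^ i *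
      (qRatio q (m - i) * qRatio q (m + i)) * pairTerm q h (n + i) (n - i) else 0
  have hF : Tendsto (fun m => ∑' i, F m i) atTop
      (𝓝 (∑' i : ℕ, symWeight i * (-1) ^ i * (L * L) * pairTerm q h (n + i) (n - i))) := by
    refine tendsto_tsum_of_dominated_convergence
      (bound := fun i : ℕ => 2 * (B * B) * ‖pairTerm q h (n + i) (n - i)‖)
      (((summable_pairTerm_centered h0 h1 hh n).comp_injective Nat.cast_injective).mul_left _)
      (fun i => ?_) (Eventually.of_forall fun m i => ?_)
    · refine Tendsto.congr' (f₁ := fun m => symWeight i * (-1) ^ i *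
        (qRatio q (m - i) * qRatio q (m + i)) * pairTerm q h (n + i) (n - i)) ?_ ?_
      · filter_upwards [eventually_ge_atTop i] with m hm
        exact (if_pos (Finset.mem_range.2 (Nat.lt_succ_of_le hm))).symm
      · exact (((hlim.comp (tendsto_sub_atTop_nat i)).mul
          (hlim.comp (tendsto_add_atTop_nat i))).const_mul _).mul_const _
    · simp only [F]
      split_ifs
      · simp only [norm_mul, norm_pow, norm_neg, norm_one, one_pow, mul_one]
        gcongr
        · exact norm_symWeight_le i
        · exact hB _
        · exact hB _
      · rw [norm_zero]; positivity
  have hfin (m : ℕ) : ∑' i, F m i =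
      cayleyProd q (q ^ n * h) m / (1 + ((q ^ n * h : ℝ) : ℂ) ^ 2) := by
    rw [← finite_sum_pairTerm h0 h1 hh n m, tsum_eq_sum (s := Finset.range (m + 1))
      fun i hi => if_neg hi]
    exact Finset.sum_congr rfl fun i hi => if_pos hi
  simp_rw [hfin] at hF
  rw [← tendsto_nhds_unique hF ((tendsto_cayleyProd h0 h1 hq n).div_const _), ← tsum_mul_left]
  exact tsum_congr fun i => by ring

lemma hasSum_pairTerm_even {q h : ℝ} (h0 : 0 < q) (h1 : q < 1) (hh : 0 < h) (hq : h ^ 2 = q)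
    (n : ℤ) :
    HasSum (fun j : ℤ => (-1) ^ j * pairTerm q h j (2 * n - j))
      (qPochInf (q : ℂ) q ^ 2 / qPochInf (q : ℂ) (-q) ^ 2 * (1 / (1 + (q : ℂ) ^ (2 * n + 1)))) := by
  have hqn : ‖(q : ℂ)‖ < 1 := by simpa [abs_of_pos h0] using h1
  have hs : Summable fun i : ℤ => (-1) ^ i * pairTerm q h (n + i) (n - i) := by
    refine ((summable_pairTerm_centered h0 h1 hh n).congr fun i => ?_).of_norm
    simp
  have hsum := hasSum_even_of_nat hs fun i => by
    rw [sub_neg_eq_add, ← sub_eq_add_neg, pairTerm_comm, zpow_neg, ← inv_zpow]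
    norm_num
  have hT := tsum_symWeight_pairTerm h0 h1 hh hq n
  have hsq : ((q ^ n * h : ℝ) : ℂ) ^ 2 = (q : ℂ) ^ (2 * n + 1) := by
    have : (q ^ n * h) ^ 2 = q ^ (2 * n + 1) := by
      rw [mul_pow, hq, zpow_add_one₀ h0.ne', mul_comm 2 n, zpow_mul]; norm_cast
    exact_mod_cast congrArg ((↑) : ℝ → ℂ) this
  rw [hsq] at hT
  have hP := qPochInf_self_ne_zero hqn
  have hM := qPochInf_neg_self_ne_zero hqn
  have hT' : ∑' i : ℕ, symWeight i * ((-1) ^ (i : ℤ) * pairTerm q h (n + i) (n - i)) =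
      qPochInf (q : ℂ) q ^ 2 / qPochInf (q : ℂ) (-q) ^ 2 *
        ((-1) ^ n / (1 + (q : ℂ) ^ (2 * n + 1))) := by
    rw [← hT, ← mul_assoc, div_pow, div_mul_div_cancel₀ (pow_ne_zero 2 hM),
      div_self (pow_ne_zero 2 hP), one_mul]
    exact tsum_congr fun i => by rw [zpow_natCast, mul_assoc]
  rw [hT'] at hsum
  have hsum := hsum.mul_left ((-1) ^ n)
  have h11 : ((-1 : ℂ) ^ n) * (-1) ^ n = 1 := by
    rw [← mul_zpow]; norm_num
  rw [← (Equiv.addLeft n).hasSum_iff]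
  have hfun : (fun j : ℤ => (-1 : ℂ) ^ j * pairTerm q h j (2 * n - j)) ∘ Equiv.addLeft n =
      fun i => (-1) ^ n * ((-1) ^ i * pairTerm q h (n + i) (n - i)) := by
    ext i
    simp only [Function.comp, Equiv.coe_addLeft]
    rw [zpow_add₀ (by norm_num), show 2 * n - (n + i) = n - i by ring, mul_assoc]
  rw [hfun]
  suffices hval : (-1) ^ n * (qPochInf (q : ℂ) q ^ 2 / qPochInf (q : ℂ) (-q) ^ 2 *
      ((-1) ^ n / (1 + (q : ℂ) ^ (2 * n + 1)))) =
      qPochInf (q : ℂ) q ^ 2 / qPochInf (q : ℂ) (-q) ^ 2 * (1 / (1 + (q : ℂ) ^ (2 * n + 1))) by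
    rwa [hval] at hsum
  linear_combination (qPochInf (q : ℂ) q ^ 2 / qPochInf (q : ℂ) (-q) ^ 2 /
    (1 + (q : ℂ) ^ (2 * n + 1))) * h11

lemma tsum_pairTerm_odd (q h : ℝ) {N : ℤ} (hN : ¬ Even N) :
    ∑' j : ℤ, (-1 : ℂ) ^ j * pairTerm q h j (N - j) = 0 := by
  have : ∑' j : ℤ, (-1 : ℂ) ^ j * pairTerm q h j (N - j) =
      ∑' j : ℤ, -((-1 : ℂ) ^ j * pairTerm q h j (N - j)) := by
    rw [← (Equiv.subLeft N).tsum_eq]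
    refine tsum_congr fun j => ?_
    rw [Equiv.subLeft_apply, sub_sub_cancel, pairTerm_comm, zpow_sub₀ (by norm_num),
      (Int.not_even_iff_odd.1 hN).neg_one_zpow, div_eq_mul_inv, ← inv_zpow]
    norm_num
  rw [tsum_neg] at this
  exact self_eq_neg.1 this

lemma summable_qpow_sq_mul {q : ℝ} (h0 : 0 < q) (h1 : q < 1) {x : ℂ} (hx : x ≠ 0) :
    Summable fun n : ℤ => (q : ℂ) ^ (n ^ 2) * x ^ n := by
  have hqc : (q : ℂ) ≠ 0 := by exact_mod_cast h0.ne'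
  have hpi : (Real.pi : ℂ) ≠ 0 := by exact_mod_cast Real.pi_ne_zero
  have hI := I_ne_zero
  have := (summable_jacobiTheta₂_term_iff (log x / (2 * Real.pi * I))
    (((-Real.log q / Real.pi : ℝ) : ℂ) * I)).2 (by
      simpa using div_pos (neg_pos.2 (Real.log_neg h0 h1)) Real.pi_pos)
  refine this.congr fun n => ?_
  unfold jacobiTheta₂_term
  rw [Complex.exp_add]
  have e1 : (2 * Real.pi * I * n * (log x / (2 * Real.pi * I)) : ℂ) = n * log x := by field_simp
  have e2 : (Real.pi * I * n ^ 2 * (((-Real.log q / Real.pi : ℝ) : ℂ) * I) : ℂ) =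
      ((n ^ 2 : ℤ) : ℂ) * log q := by
    push_cast
    rw [ofReal_log h0.le]
    field_simp
    rw [I_sq]
    ring
  rw [e1, e2, exp_int_mul, exp_int_mul, exp_log hx, exp_log hqc, mul_comm]

lemma summable_shear {q h : ℝ} (h0 : 0 < q) (h1 : q < 1) (hh : 0 < h) {x : ℂ} (hx : x ≠ 0) :
    Summable fun p : ℤ × ℤ => (q : ℂ) ^ (p.1 ^ 2) * x ^ p.1 *
      ((-1) ^ p.2 * pairTerm q h p.2 (p.1 - p.2)) := by
  have hqc : (q : ℂ) ≠ 0 := by exact_mod_cast h0.ne'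
  have hA : Summable fun N : ℤ => h⁻¹ * (‖(q : ℂ) ^ (N ^ 2) * x ^ N‖ +
      ‖(q : ℂ) ^ (N ^ 2) * (x / q) ^ N‖) :=
    ((summable_qpow_sq_mul h0 h1 hx).norm.add
      (summable_qpow_sq_mul h0 h1 (div_ne_zero hx hqc)).norm).mul_left _
  refine (hA.mul_of_nonneg (summable_pow_natAbs h0 h1) (fun N => by positivity)
    (fun j => by positivity)).of_norm_bounded fun p => ?_
  have hb := norm_pairTerm_le h0 hh p.2 p.1
  have hsg : ‖(-1 : ℂ) ^ p.2‖ = 1 := by simp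
  have hqN : ‖(q : ℂ) ^ p.1‖ = q ^ p.1 := by rw [norm_zpow, norm_real, Real.norm_of_nonneg h0.le]
  rw [div_zpow, ← mul_div_assoc, norm_div, hqN, norm_mul _ (_ * _), norm_mul (_ ^ p.2), hsg, one_mul]
  refine (mul_le_mul_of_nonneg_left hb (norm_nonneg _)).trans_eq ?_
  ring

/-- Rogers–Ramanujan type identity:
`((q;q)_∞²/(−q;q)_∞²)·Σ_{n∈ℤ} q^{4n²}x^{2n}/(1+q^{2n+1})
  = Σ_{j,k∈ℤ} q^{(j+k)²}(−1)^j x^{j+k}/((1+iq^{j+1/2})(1+iq^{k+1/2}))`,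
both sides converging absolutely. -/
theorem rogers_ramanujan_type_two (q : ℝ) (hq0 : 0 < q) (hq1 : q < 1) (x : ℂ) (hx : x ≠ 0) :
    Summable (fun n : ℤ => (q : ℂ) ^ (4 * n ^ 2) * x ^ (2 * n) / (1 + (q : ℂ) ^ (2 * n + 1))) ∧
    Summable (fun p : ℤ × ℤ => (q : ℂ) ^ ((p.1 + p.2) ^ 2) * (-1) ^ p.1 * x ^ (p.1 + p.2) /
      ((1 + Complex.I * ((q ^ ((p.1 : ℝ) + 1 / 2) : ℝ) : ℂ)) *
        (1 + Complex.I * ((q ^ ((p.2 : ℝ) + 1 / 2) : ℝ) : ℂ)))) ∧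
    qPochInf (q : ℂ) (q : ℂ) ^ 2 / qPochInf (q : ℂ) (-(q : ℂ)) ^ 2 *
      ∑' n : ℤ, (q : ℂ) ^ (4 * n ^ 2) * x ^ (2 * n) / (1 + (q : ℂ) ^ (2 * n + 1))
    = ∑' p : ℤ × ℤ, (q : ℂ) ^ ((p.1 + p.2) ^ 2) * (-1) ^ p.1 * x ^ (p.1 + p.2) /
        ((1 + Complex.I * ((q ^ ((p.1 : ℝ) + 1 / 2) : ℝ) : ℂ)) *
          (1 + Complex.I * ((q ^ ((p.2 : ℝ) + 1 / 2) : ℝ) : ℂ))) := by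
  obtain ⟨h, hh, hhq, hpow⟩ : ∃ h : ℝ, 0 < h ∧ h ^ 2 = q ∧
      ∀ j : ℤ, q ^ ((j : ℝ) + 1 / 2) = q ^ j * h := by
    refine ⟨√q, Real.sqrt_pos.2 hq0, Real.sq_sqrt hq0.le, fun j => ?_⟩
    rw [Real.rpow_add hq0, Real.rpow_intCast, Real.sqrt_eq_rpow]
  have hinj : Function.Injective fun n : ℤ => 2 * n := mul_right_injective₀ two_ne_zero
  have hsq (n : ℤ) : 4 * n ^ 2 = (2 * n) ^ 2 := by ring
  set S : ℤ × ℤ → ℂ := fun p => (q : ℂ) ^ (p.1 ^ 2) * x ^ p.1 *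
      ((-1) ^ p.2 * pairTerm q h p.2 (p.1 - p.2)) with hS
  have hsum : Summable S := summable_shear hq0 hq1 hh hx
  let e : ℤ × ℤ ≃ ℤ × ℤ :=
    ⟨fun p => (p.1 + p.2, p.1), fun p => (p.2, p.1 - p.2), fun p => by simp, fun p => by simp⟩
  have hterm : (fun p : ℤ × ℤ => (q : ℂ) ^ ((p.1 + p.2) ^ 2) * (-1) ^ p.1 * x ^ (p.1 + p.2) /
      ((1 + Complex.I * ((q ^ ((p.1 : ℝ) + 1 / 2) : ℝ) : ℂ)) *
        (1 + Complex.I * ((q ^ ((p.2 : ℝ) + 1 / 2) : ℝ) : ℂ)))) = S ∘ e := by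
    ext p
    simp only [hS, e, Function.comp, Equiv.coe_fn_mk, add_sub_cancel_left, hpow, pairTerm]
    rw [← mul_inv, div_eq_mul_inv]
    ring
  refine ⟨?_, ?_, ?_⟩
  · refine ((summable_qpow_sq_mul hq0 hq1 hx).comp_injective hinj).norm.of_norm_bounded fun n => ?_
    rw [Function.comp, hsq, norm_div]
    refine div_le_self (norm_nonneg _) ?_
    have hp : 0 < q ^ (2 * n + 1) := zpow_pos hq0 _
    have : ‖(1 : ℂ) + (q : ℂ) ^ (2 * n + 1)‖ = 1 + q ^ (2 * n + 1) := by
      rw [← ofReal_zpow, ← ofReal_one, ← ofReal_add, norm_real, Real.norm_of_nonneg (by positivity)]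
    linarith
  · rw [hterm]
    exact e.summable_iff.2 hsum
  · rw [hterm]
    rw [show ∑' p, (S ∘ e) p = ∑' p, S p from e.tsum_eq S, hsum.tsum_prod]
    simp only [hS, tsum_mul_left]
    rw [← hinj.tsum_eq (f := fun N : ℤ => (q : ℂ) ^ (N ^ 2) * x ^ N *
      ∑' j : ℤ, (-1 : ℂ) ^ j * pairTerm q h j (N - j)), ← tsum_mul_left]
    · refine tsum_congr fun n => ?_
      rw [(hasSum_pairTerm_even hq0 hq1 hh hhq n).tsum_eq, hsq]
      ring
    · intro N hN
      by_contra hr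
      refine hN ?_
      have hodd : ¬ Even N := fun ⟨k, hk⟩ => hr ⟨k, by simp only [hk]; ring⟩
      simp only [tsum_pairTerm_odd q h hodd, mul_zero]
end

section
/- Explicit formulas for the generalized Schur polynomials: for every a ∈ ℂ and every integer n ≥ 2, c_n(a,q) = Σ_{j=0}^{⌊(n−2)/2⌋} q^{j(j+1)} [n−j−2 choose j]_q a^{n−2j−2}, and for every integer n ≥ 1, d_n(a,q) = Σ_{j=0}^{⌊(n−1)/2⌋} q^{j²} [n−j−1 choose j]_q a^{n−2j−1}, where [m choose j]_q = (q;q)_m/((q;q)_j (q;q)_{m−j}) is the q-binomial coefficient. -/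
open Complex

/-- The q-binomial coefficient `[m choose j]_q = (q;q)_m/((q;q)_j (q;q)_{m−j})`. -/
noncomputable def qBinom (q : ℝ) (m j : ℕ) : ℂ :=
  qPoch (q : ℂ) (q : ℂ) m / (qPoch (q : ℂ) (q : ℂ) j * qPoch (q : ℂ) (q : ℂ) (m - j))

/-- The solution of the recurrence `y_{m+1} = q^{m−1} y_{m−1} + a y_m` (for `m ≥ 1`)
with initial values `y_0`, `y_1`. -/
noncomputable def schurRec (q : ℝ) (a y0 y1 : ℂ) : ℕ → ℂ
  | 0 => y0
  | 1 => y1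
  | (m + 2) => (q : ℂ) ^ m * schurRec q a y0 y1 m + a * schurRec q a y0 y1 (m + 1)

/-- The generalized Schur polynomial `c_n(a,q)`: `c_0 = 1`, `c_1 = 0`. -/
noncomputable def schurC (q : ℝ) (a : ℂ) (n : ℕ) : ℂ := schurRec q a 1 0 n

/-- The generalized Schur polynomial `d_n(a,q)`: `d_0 = 0`, `d_1 = 1`. -/
noncomputable def schurD (q : ℝ) (a : ℂ) (n : ℕ) : ℂ := schurRec q a 0 1 n

/-- The Gaussian binomial polynomial, defined by the `q`-Pascal rule. -/
noncomputable def gaussBinom (q : ℂ) : ℕ → ℕ → ℂ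
  | _, 0 => 1
  | 0, _ + 1 => 0
  | m + 1, j + 1 => gaussBinom q m (j + 1) + q ^ (m - j) * gaussBinom q m j

theorem gaussBinom_zero_right (q : ℂ) (m : ℕ) : gaussBinom q m 0 = 1 := by
  cases m <;> rfl

theorem gaussBinom_succ_succ (q : ℂ) (m j : ℕ) :
    gaussBinom q (m + 1) (j + 1) = gaussBinom q m (j + 1) + q ^ (m - j) * gaussBinom q m j :=
  rfl

theorem gaussBinom_eq_zero_of_lt (q : ℂ) {m j : ℕ} (h : m < j) : gaussBinom q m j = 0 := by
  induction m generalizing j with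
  | zero =>
    obtain ⟨i, rfl⟩ : ∃ i, j = i + 1 := ⟨j - 1, by omega⟩
    rfl
  | succ m ih =>
    obtain ⟨i, rfl⟩ : ∃ i, j = i + 1 := ⟨j - 1, by omega⟩
    rw [gaussBinom_succ_succ, ih (by omega), ih (by omega)]
    ring

theorem qPoch_self_succ (q : ℂ) (n : ℕ) :
    qPoch q q (n + 1) = qPoch q q n * (1 - q ^ (n + 1)) := by
  rw [qPoch, Finset.prod_range_succ, ← qPoch, pow_succ']

theorem gaussBinom_add_mul_qPoch (q : ℂ) (j k : ℕ) :
    gaussBinom q (j + k) j * (qPoch q q j * qPoch q q k) = qPoch q q (j + k) := by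
  induction hm : j + k generalizing j k with
  | zero =>
    obtain ⟨rfl, rfl⟩ : j = 0 ∧ k = 0 := by omega
    simp [gaussBinom_zero_right, qPoch]
  | succ m ih =>
    rcases j with _ | j
    · obtain rfl : k = m + 1 := by omega
      simp [gaussBinom_zero_right, qPoch]
    · have h₁ := ih j k (by omega)
      rw [gaussBinom_succ_succ, show m - j = k by omega]
      rcases k with _ | k
      · obtain rfl : m = j := by omega
        rw [gaussBinom_eq_zero_of_lt q m.lt_succ_self, qPoch_self_succ]
        linear_combination (1 - q ^ (m + 1)) * h₁
      · have h₂ := ih (j + 1) k (by omega)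
        obtain rfl : m = j + k + 1 := by omega
        rw [qPoch_self_succ q (j + k + 1)]
        rw [qPoch_self_succ q j] at h₂ ⊢
        rw [qPoch_self_succ q k] at h₁ ⊢
        linear_combination (1 - q ^ (k + 1)) * h₂ + q ^ (k + 1) * (1 - q ^ (j + 1)) * h₁

theorem qPoch_self_ne_zero {q : ℝ} (hq0 : 0 < q) (hq1 : q < 1) (n : ℕ) :
    qPoch (q : ℂ) (q : ℂ) n ≠ 0 := by
  refine Finset.prod_ne_zero_iff.mpr fun i _ => ?_
  rw [← pow_succ']
  have h : q ^ (i + 1) < 1 := pow_lt_one₀ hq0.le hq1 i.succ_ne_zero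
  exact_mod_cast (sub_pos.mpr h).ne'

theorem qBinom_eq_gaussBinom {q : ℝ} (hq0 : 0 < q) (hq1 : q < 1) {m j : ℕ} (h : j ≤ m) :
    qBinom q m j = gaussBinom q m j := by
  have := gaussBinom_add_mul_qPoch q j (m - j)
  rw [Nat.add_sub_cancel' h] at this
  rw [qBinom, div_eq_iff (mul_ne_zero (qPoch_self_ne_zero hq0 hq1 _)
    (qPoch_self_ne_zero hq0 hq1 _)), this]

/-- The `j`-th summand of the explicit formula for the shifted Schur polynomials. -/
noncomputable def schurTerm (q a : ℂ) (t n j : ℕ) : ℂ :=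
  q ^ (j ^ 2 + t * j) * gaussBinom q (n - j) j * a ^ (n - 2 * j)

theorem schurTerm_eq_zero_of_lt (q a : ℂ) (t : ℕ) {n j : ℕ} (h : n < 2 * j) :
    schurTerm q a t n j = 0 := by
  rw [schurTerm, gaussBinom_eq_zero_of_lt q (by omega)]
  ring

theorem schurTerm_add_two_zero (q a : ℂ) (t n : ℕ) :
    schurTerm q a t (n + 2) 0 = a * schurTerm q a t (n + 1) 0 := by
  simp [schurTerm, gaussBinom_zero_right, pow_succ']

theorem schurTerm_add_two_succ (q a : ℂ) (t n j : ℕ) :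
    schurTerm q a t (n + 2) (j + 1) =
      q ^ (n + 1 + t) * schurTerm q a t n j + a * schurTerm q a t (n + 1) (j + 1) := by
  rcases lt_or_ge n (2 * j) with h | h
  · rw [schurTerm_eq_zero_of_lt _ _ _ h, schurTerm_eq_zero_of_lt _ _ _ (by omega),
      schurTerm_eq_zero_of_lt _ _ _ (by omega)]
    ring
  obtain ⟨k, rfl⟩ := Nat.exists_eq_add_of_le h
  simp only [schurTerm]
  rw [show 2 * j + k + 2 - (j + 1) = (j + k) + 1 by omega,
    show 2 * j + k + 2 - 2 * (j + 1) = k by omega, show 2 * j + k - j = j + k by omega,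
    show 2 * j + k - 2 * j = k by omega, show 2 * j + k + 1 - (j + 1) = j + k by omega,
    show 2 * j + k + 1 - 2 * (j + 1) = k - 1 by omega, gaussBinom_succ_succ,
    show j + k - j = k by omega]
  rcases k with _ | k
  · rw [gaussBinom_eq_zero_of_lt q (show j + 0 < j + 1 by omega)]
    ring
  · rw [Nat.add_sub_cancel]
    ring

/-- The shifted Schur polynomials in explicit form. -/
noncomputable def schurSum (q a : ℂ) (t n : ℕ) : ℂ :=
  ∑ j ∈ Finset.range (n / 2 + 1), schurTerm q a t n j

theorem schurSum_eq_sum_range (q a : ℂ) (t : ℕ) {n k : ℕ} (h : n / 2 + 1 ≤ k) :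
    schurSum q a t n = ∑ j ∈ Finset.range k, schurTerm q a t n j := by
  refine Finset.sum_subset (Finset.range_mono h) fun j _ hj => ?_
  rw [Finset.mem_range] at hj
  exact schurTerm_eq_zero_of_lt _ _ _ (by omega)

theorem schurSum_add_two (q a : ℂ) (t n : ℕ) :
    schurSum q a t (n + 2) =
      q ^ (n + 1 + t) * schurSum q a t n + a * schurSum q a t (n + 1) := by
  rw [schurSum_eq_sum_range q a t (show (n + 2) / 2 + 1 ≤ n + 2 + 1 by omega),
    schurSum_eq_sum_range q a t (show (n + 1) / 2 + 1 ≤ n + 2 + 1 by omega),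
    schurSum_eq_sum_range q a t (show n / 2 + 1 ≤ n + 2 by omega),
    Finset.sum_range_succ', Finset.sum_range_succ' _ (n + 2), schurTerm_add_two_zero]
  simp only [schurTerm_add_two_succ, Finset.sum_add_distrib, ← Finset.mul_sum]
  ring

theorem schurSum_zero (q a : ℂ) (t : ℕ) : schurSum q a t 0 = 1 := by
  simp [schurSum, schurTerm, gaussBinom_zero_right]

theorem schurSum_one (q a : ℂ) (t : ℕ) : schurSum q a t 1 = a := by
  simp [schurSum, schurTerm, gaussBinom_zero_right]

theorem schurRec_add_two (q : ℝ) (a y0 y1 : ℂ) (m : ℕ) :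
    schurRec q a y0 y1 (m + 2) =
      (q : ℂ) ^ m * schurRec q a y0 y1 m + a * schurRec q a y0 y1 (m + 1) := by
  rw [schurRec]

theorem schurC_add_two (q : ℝ) (a : ℂ) (n : ℕ) : schurC q a (n + 2) = schurSum q a 1 n := by
  induction n using Nat.twoStepInduction with
  | zero => simp [schurC, schurRec, schurSum_zero]
  | one => simp [schurC, schurRec, schurSum_one]
  | more n h₀ h₁ =>
    rw [schurSum_add_two, ← h₀, ← h₁]
    exact schurRec_add_two q a 1 0 (n + 2)

theorem schurD_add_one (q : ℝ) (a : ℂ) (n : ℕ) : schurD q a (n + 1) = schurSum q a 0 n := by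
  induction n using Nat.twoStepInduction with
  | zero => simp [schurD, schurRec, schurSum_zero]
  | one => simp [schurD, schurRec, schurSum_one]
  | more n h₀ h₁ =>
    rw [schurSum_add_two, ← h₀, ← h₁]
    exact schurRec_add_two q a 0 1 (n + 1)

/-- explicit formulas:
for `n ≥ 2`, `c_n(a,q) = Σ_{j=0}^{⌊(n−2)/2⌋} q^{j(j+1)} [n−j−2 choose j]_q a^{n−2j−2}`, and
for `n ≥ 1`, `d_n(a,q) = Σ_{j=0}^{⌊(n−1)/2⌋} q^{j²} [n−j−1 choose j]_q a^{n−2j−1}`. -/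
theorem schur_explicit_formulas (q : ℝ) (hq0 : 0 < q) (hq1 : q < 1) (a : ℂ) :
    (∀ n : ℕ, 2 ≤ n →
      schurC q a n = ∑ j ∈ Finset.range ((n - 2) / 2 + 1),
        (q : ℂ) ^ (j * (j + 1)) * qBinom q (n - j - 2) j * a ^ (n - 2 * j - 2)) ∧
    (∀ n : ℕ, 1 ≤ n →
      schurD q a n = ∑ j ∈ Finset.range ((n - 1) / 2 + 1),
        (q : ℂ) ^ (j ^ 2) * qBinom q (n - j - 1) j * a ^ (n - 2 * j - 1)) := by
  refine ⟨fun n hn => ?_, fun n hn => ?_⟩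
  · obtain ⟨m, rfl⟩ := Nat.exists_eq_add_of_le' hn
    rw [schurC_add_two, schurSum, Nat.add_sub_cancel]
    refine Finset.sum_congr rfl fun j hj => ?_
    rw [Finset.mem_range] at hj
    rw [schurTerm, show m + 2 - j - 2 = m - j by omega,
      show m + 2 - 2 * j - 2 = m - 2 * j by omega,
      qBinom_eq_gaussBinom hq0 hq1 (by omega), show j ^ 2 + 1 * j = j * (j + 1) by ring]
  · obtain ⟨m, rfl⟩ := Nat.exists_eq_add_of_le' hn
    rw [schurD_add_one, schurSum, Nat.add_sub_cancel]
    refine Finset.sum_congr rfl fun j hj => ?_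
    rw [Finset.mem_range] at hj
    rw [schurTerm, show m + 1 - j - 1 = m - j by omega,
      show m + 1 - 2 * j - 1 = m - 2 * j by omega,
      qBinom_eq_gaussBinom hq0 hq1 (by omega), zero_mul, add_zero]
end
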